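/- (Non-compactness of PoCTL) Let a be an atomic proposition. The set of PoCTL formulae Γ = {Po_{<1}(◯a)} ∪ {Po_{≥1−1/n}(◯a) : n∈ℕ, n≥1} is unsatisfiable (there is no PKS M and state s with M,s⊨Φ for every Φ∈Γ), yet every finite subset of Γ is satisfiable. Hence PoCTL is not compact. -/

import Mathlib

open Set

/-- An interval `J ⊆ [0,1]` with rational bounds. -/
inductive RatInterval : Type where
  | icc (u v : ℚ)
  | ioc (u v : ℚ)
  | ico (u v : ℚ)
  | ioo (u v : ℚ)
  deriving DecidableEq

/-- Membership of a real number in a rational-bounded interval. -/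
def RatInterval.mem : RatInterval → ℝ → Prop
  | .icc u v, x => (u : ℝ) ≤ x ∧ x ≤ (v : ℝ)
  | .ioc u v, x => (u : ℝ) < x ∧ x ≤ (v : ℝ)
  | .ico u v, x => (u : ℝ) ≤ x ∧ x < (v : ℝ)
  | .ioo u v, x => (u : ℝ) < x ∧ x < (v : ℝ)

mutual
/-- PoCTL state formulae (including the derived connective `∨`, the necessity
operator `Ne_J`, and in path formulae the operators `𝐑`, `◇`). -/
inductive SF (A : Type) : Type where
  | tt : SF A
  | atom : A → SF A
  | and : SF A → SF A → SF A
  | or : SF A → SF A → SF A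
  | not : SF A → SF A
  | po : RatInterval → PF A → SF A
  | ne : RatInterval → PF A → SF A

/-- PoCTL path formulae. -/
inductive PF (A : Type) : Type where
  | next : SF A → PF A
  | untl : SF A → SF A → PF A
  | buntl : ℕ → SF A → SF A → PF A
  | rel : SF A → SF A → PF A
  | ev : SF A → PF A
  | box : SF A → PF A
end

/-- `Po_{≥r}(φ)`. -/
def poGe {A : Type} (r : ℚ) (φ : PF A) : SF A := .po (.icc r 1) φ
/-- `Po_{>r}(φ)`. -/
def poGt {A : Type} (r : ℚ) (φ : PF A) : SF A := .po (.ioc r 1) φ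
/-- `Po_{≤r}(φ)`. -/
def poLe {A : Type} (r : ℚ) (φ : PF A) : SF A := .po (.icc 0 r) φ
/-- `Po_{<r}(φ)`. -/
def poLt {A : Type} (r : ℚ) (φ : PF A) : SF A := .po (.ico 0 r) φ
/-- `Ne_{≥r}(φ)`. -/
def neGe {A : Type} (r : ℚ) (φ : PF A) : SF A := .ne (.icc r 1) φ
/-- `Ne_{>r}(φ)`. -/
def neGt {A : Type} (r : ℚ) (φ : PF A) : SF A := .ne (.ioc r 1) φ
/-- `Ne_{≤r}(φ)`. -/
def neLe {A : Type} (r : ℚ) (φ : PF A) : SF A := .ne (.icc 0 r) φ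
/-- `Ne_{<r}(φ)`. -/
def neLt {A : Type} (r : ℚ) (φ : PF A) : SF A := .ne (.ico 0 r) φ
/-- A possibilistic Kripke structure over states `S` and atomic propositions `A`. -/
structure PKS (S A : Type) where
  P : S → S → ℝ
  init : S → ℝ
  L : S → Set A
  countable : Countable S
  nonempty : Nonempty S
  P_nonneg : ∀ s t, 0 ≤ P s t
  P_le_one : ∀ s t, P s t ≤ 1
  P_sup : ∀ s, (⨆ t, P s t) = 1
  init_nonneg : ∀ s, 0 ≤ init s
  init_le_one : ∀ s, init s ≤ 1
  init_sup : (⨆ s, init s) = 1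

variable {S A : Type}

/-- `π` is a path of `M`: all transition possibilities along `π` are positive. -/
def PKS.IsPath (M : PKS S A) (π : ℕ → S) : Prop := ∀ i, 0 < M.P (π i) (π (i + 1))

/-- The set of all paths of `M`. -/
def PKS.Paths (M : PKS S A) : Set (ℕ → S) := {π | M.IsPath π}

/-- `Po^{M_s}(π) = inf { P(sᵢ,sᵢ₊₁) : i ≥ 0 }`, the possibility of a path in the
structure with unique initial state `π 0`. -/
noncomputable def PKS.poPathFrom (M : PKS S A) (π : ℕ → S) : ℝ :=
  ⨅ i, M.P (π i) (π (i + 1))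

mutual
/-- Satisfaction of PoCTL state formulae at a state of a PKS. -/
def SF.Sat (M : PKS S A) (s : S) : SF A → Prop
  | .tt => True
  | .atom a => a ∈ M.L s
  | .and Φ Ψ => SF.Sat M s Φ ∧ SF.Sat M s Ψ
  | .or Φ Ψ => SF.Sat M s Φ ∨ SF.Sat M s Ψ
  | .not Φ => ¬ SF.Sat M s Φ
  | .po J φ => J.mem (sSup {x : ℝ | ∃ π : ℕ → S,
      M.IsPath π ∧ π 0 = s ∧ PF.Sat M π φ ∧ x = M.poPathFrom π})
  | .ne J φ => J.mem (1 - sSup {x : ℝ | ∃ π : ℕ → S,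
      M.IsPath π ∧ π 0 = s ∧ ¬ PF.Sat M π φ ∧ x = M.poPathFrom π})

/-- Satisfaction of PoCTL path formulae along a path of a PKS. -/
def PF.Sat (M : PKS S A) (π : ℕ → S) : PF A → Prop
  | .next Φ => SF.Sat M (π 1) Φ
  | .untl Φ Ψ => ∃ k, SF.Sat M (π k) Ψ ∧ ∀ i < k, SF.Sat M (π i) Φ
  | .buntl n Φ Ψ => ∃ k ≤ n, SF.Sat M (π k) Ψ ∧ ∀ i < k, SF.Sat M (π i) Φ
  | .rel Φ Ψ => ∀ j, ¬ SF.Sat M (π j) Ψ → ∃ k < j, SF.Sat M (π k) Φ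
  | .ev Φ => ∃ j, SF.Sat M (π j) Φ
  | .box Φ => ∀ j, SF.Sat M (π j) Φ
end

/-- Equivalence of PoCTL state formulae: same truth value at every state of every PKS. -/
def SFEquiv {A : Type} (Φ Ψ : SF A) : Prop :=
  ∀ (S : Type) (M : PKS S A) (s : S), SF.Sat M s Φ ↔ SF.Sat M s Ψ
/-- A set `Γ` of PoCTL formulae is satisfiable: some state of some PKS satisfies every
formula of `Γ`. -/
def SetSatisfiable {A : Type} (Γ : Set (SF A)) : Prop :=
  ∃ (S : Type) (M : PKS S A) (s : S), ∀ Φ ∈ Γ, SF.Sat M s Φ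

open Filter Topology in
/-- For a fixed threshold `1 - 1 / n < 1`, all reals sufficiently close to `1` from below
exceed it. -/
theorem eventually_one_sub_one_div_le (n : ℕ) (hn : 1 ≤ n) :
    ∀ᶠ c in 𝓝[<] (1 : ℝ), 1 - 1 / (n : ℝ) ≤ c := by
  have hpos : (0 : ℝ) < 1 / (n : ℝ) := by positivity
  filter_upwards [Ioo_mem_nhdsLT (show 1 - 1 / (n : ℝ) < 1 by linarith)] with c hc
  exact hc.1.le

theorem iSup_ite_eq_one {c : ℝ} (h1 : c ≤ 1) : (⨆ t : Bool, if t then c else 1) = 1 := by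
  refine le_antisymm (ciSup_le fun t => by cases t <;> simp [h1]) ?_
  exact le_ciSup (f := fun t : Bool => if t then c else (1 : ℝ)) (finite_range _).bddAbove false

/-- The two-state structure in which moving to `true` has possibility `c`, moving to `false`
has possibility `1`, and every proposition holds exactly at `true`. -/
noncomputable def twoState (A : Type) (c : ℝ) (h0 : 0 < c) (h1 : c < 1) : PKS Bool A where
  P _ t := if t then c else 1
  init t := if t then c else 1
  L t := {_x | t = true}
  countable := inferInstance
  nonempty := inferInstance
  P_nonneg _ t := by cases t <;> simp [h0.le]
  P_le_one _ t := by cases t <;> simp [h1.le]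
  P_sup _ := iSup_ite_eq_one h1.le
  init_nonneg t := by cases t <;> simp [h0.le]
  init_le_one t := by cases t <;> simp [h1.le]
  init_sup := iSup_ite_eq_one h1.le

theorem twoState_le_P {A : Type} {c : ℝ} (h0 : 0 < c) (h1 : c < 1) (s t : Bool) :
    c ≤ (twoState A c h0 h1).P s t := by
  cases t <;> simp [twoState, h1.le]

theorem twoState_poPathFrom {A : Type} {c : ℝ} (h0 : 0 < c) (h1 : c < 1) {π : ℕ → Bool}
    (hπ : π 1 = true) : (twoState A c h0 h1).poPathFrom π = c := by
  refine le_antisymm ?_ (le_ciInf fun i => twoState_le_P h0 h1 _ _)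
  have hb : BddBelow (range fun i => (twoState A c h0 h1).P (π i) (π (i + 1))) :=
    ⟨c, by rintro _ ⟨i, rfl⟩; exact twoState_le_P h0 h1 _ _⟩
  exact (ciInf_le hb 0).trans (by simp [twoState, hπ])

/-- At state `false` of `twoState`, the formula `Po_J(◯a)` says that `c ∈ J`. -/
theorem twoState_sat_po_next {A : Type} (a : A) {c : ℝ} (h0 : 0 < c) (h1 : c < 1)
    (J : RatInterval) :
    SF.Sat (twoState A c h0 h1) false (.po J (.next (.atom a))) ↔ J.mem c := by
  have hset : {x : ℝ | ∃ π : ℕ → Bool, (twoState A c h0 h1).IsPath π ∧ π 0 = false ∧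
      PF.Sat (twoState A c h0 h1) π (.next (.atom a)) ∧
      x = (twoState A c h0 h1).poPathFrom π} = {c} := by
    ext x
    simp only [mem_ofPred_eq, mem_singleton_iff, PF.Sat, SF.Sat]
    constructor
    · rintro ⟨π, -, -, hπ, rfl⟩
      exact twoState_poPathFrom h0 h1 hπ
    · rintro rfl
      refine ⟨fun i => decide (i ≠ 0), fun i => h0.trans_le (twoState_le_P h0 h1 _ _),
        by simp, by simp [twoState], (twoState_poPathFrom h0 h1 (by simp)).symm⟩
  rw [SF.Sat, hset, csSup_singleton]

/-- **Non-compactness of PoCTL.** Let `a` be an atomic proposition. The set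
`Γ = {Po_{<1}(◯a)} ∪ {Po_{≥1−1/n}(◯a) : n ∈ ℕ, n ≥ 1}` is unsatisfiable, yet every
finite subset of `Γ` is satisfiable. Hence PoCTL is not compact. -/
theorem poctl_not_compact {A : Type} (a : A) (Γ : Set (SF A))
    (hΓ : Γ = insert (poLt 1 (.next (.atom a)))
      {Φ : SF A | ∃ n : ℕ, 1 ≤ n ∧ Φ = poGe (1 - 1 / (n : ℚ)) (.next (.atom a))}) :
    ¬ SetSatisfiable Γ ∧ ∀ Γ' ⊆ Γ, Γ'.Finite → SetSatisfiable Γ' := by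
  subst hΓ
  constructor
  · rintro ⟨S, M, s, h⟩
    have hlt := h _ (mem_insert _ _)
    have hge := fun (n : ℕ) (hn : 1 ≤ n) => h _ (mem_insert_of_mem _ ⟨n, hn, rfl⟩)
    simp only [poLt, poGe, SF.Sat, RatInterval.mem] at hlt hge
    obtain ⟨n, hn⟩ := exists_nat_one_div_lt (sub_pos.2 hlt.2)
    have := (hge (n + 1) (by omega)).1
    push_cast at this hn
    linarith
  · intro Γ' hsub hfin
    have hev : ∀ᶠ c in nhdsWithin (1 : ℝ) (Iio 1), ∀ Φ ∈ Γ', ∀ (h0 : 0 < c) (h1 : c < 1),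
        SF.Sat (twoState A c h0 h1) false Φ := by
      refine (Filter.eventually_all_finite hfin).2 fun Φ hΦ => ?_
      rcases hsub hΦ with rfl | ⟨n, hn, rfl⟩
      · refine Filter.Eventually.of_forall fun c h0 h1 => ?_
        rw [poLt, twoState_sat_po_next]
        simpa [RatInterval.mem] using ⟨h0.le, h1⟩
      · filter_upwards [eventually_one_sub_one_div_le n hn] with c hc h0 h1
        rw [poGe, twoState_sat_po_next]
        simp only [RatInterval.mem]
        push_cast
        exact ⟨hc, h1.le⟩
    obtain ⟨c, hc, h0, h1⟩ := (hev.and (Ioo_mem_nhdsLT one_pos)).exists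
    exact ⟨Bool, twoState A c h0 h1, false, fun Φ hΦ => hc Φ hΦ h0 h1⟩
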